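/- Let E be a complete random normed module with full support and f ∈ 𝒞(E). Then f belongs to the class 𝒜(E) of L⁰-affine functions if and only if there exists a unique pair (u, α) ∈ E* × L⁰(F) such that the set of L⁰-affine minorants of f equals {h_{u,β} : β ∈ L⁰(F), β ≤ α}, where h_{u,β}(x) = u(x) + β. -/

import Mathlib

open MeasureTheory Filter Topology ENNReal
open scoped Classical

namespace RandomNormed

variable {Ω : Type*} [MeasurableSpace Ω] {μ : Measure Ω}

/-! `Ω →ₘ[μ] ℝ` is our model of `L⁰(F)`: equivalence classes of real random variables.
We equip it with its (pointwise a.e.) commutative ring structure. -/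

noncomputable instance : NatCast (Ω →ₘ[μ] ℝ) := ⟨fun n => AEEqFun.const Ω (n : ℝ)⟩
noncomputable instance : IntCast (Ω →ₘ[μ] ℝ) := ⟨fun n => AEEqFun.const Ω (n : ℝ)⟩

theorem natCast_toGerm (n : ℕ) : ((n : Ω →ₘ[μ] ℝ)).toGerm = n := by
  show (AEEqFun.const Ω (n:ℝ)).toGerm = _
  rw [AEEqFun.const, AEEqFun.mk_toGerm]; rfl

theorem intCast_toGerm (n : ℤ) : ((n : Ω →ₘ[μ] ℝ)).toGerm = n := by
  show (AEEqFun.const Ω (n:ℝ)).toGerm = _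
  rw [AEEqFun.const, AEEqFun.mk_toGerm]; rfl

noncomputable instance : CommRing (Ω →ₘ[μ] ℝ) :=
  AEEqFun.toGerm_injective.commRing AEEqFun.toGerm AEEqFun.zero_toGerm AEEqFun.one_toGerm
    AEEqFun.add_toGerm AEEqFun.mul_toGerm AEEqFun.neg_toGerm AEEqFun.sub_toGerm
    (fun _ _ => AEEqFun.smul_toGerm _ _) (fun _ _ => AEEqFun.smul_toGerm _ _)
    AEEqFun.pow_toGerm natCast_toGerm intCast_toGerm

/-- The Ky Fan functional `ξ ↦ ∫ (|ξ| ∧ 1) dμ`: it metrizes the `(ε,λ)`-topology, i.e. the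
topology of convergence in probability, on `L⁰(F) = Ω →ₘ[μ] ℝ`. -/
noncomputable def dP (μ : Measure Ω) (ξ : Ω →ₘ[μ] ℝ) : ℝ≥0∞ :=
  ∫⁻ ω, ENNReal.ofReal (min |ξ ω| 1) ∂μ

section RN

variable {E : Type*} [AddCommGroup E] [Module (Ω →ₘ[μ] ℝ) E]

/-- `nrm` is an `L⁰`-norm on the `L⁰(F)`-module `E`. -/
def IsRNNorm (nrm : E → Ω →ₘ[μ] ℝ) : Prop :=
  (∀ x, 0 ≤ nrm x) ∧ (∀ (ξ : Ω →ₘ[μ] ℝ) (x : E), nrm (ξ • x) = |ξ| * nrm x) ∧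
    (∀ x y, nrm (x + y) ≤ nrm x + nrm y) ∧ (∀ x, nrm x = 0 → x = 0)

/-- Completeness of the random normed module `(E, nrm)` with respect to the
`(ε,λ)`-topology: every Cauchy (in probability) sequence converges in probability. -/
def IsCompleteRN (nrm : E → Ω →ₘ[μ] ℝ) : Prop :=
  ∀ x : ℕ → E,
    (∀ ε : ℝ≥0∞, 0 < ε → ∃ N, ∀ m, N ≤ m → ∀ n, N ≤ n → dP μ (nrm (x m - x n)) < ε) →
    ∃ l : E, Tendsto (fun n => dP μ (nrm (x n - l))) atTop (nhds 0)

/-- The random normed module `(E, nrm)` has full support: on no set of positive measure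
do all the norms vanish. -/
def HasFullSupport (nrm : E → Ω →ₘ[μ] ℝ) : Prop :=
  ∀ A : Set Ω, MeasurableSet A → μ A ≠ 0 → ∃ x : E, ¬ (∀ᵐ ω ∂μ, ω ∈ A → nrm x ω = 0)

/-- An `L⁰`-linear functional is a.s. bounded (equivalently, continuous), i.e. a member of
the random conjugate space `E*`. -/
def IsBoundedLF (nrm : E → Ω →ₘ[μ] ℝ) (u : E →ₗ[Ω →ₘ[μ] ℝ] (Ω →ₘ[μ] ℝ)) : Prop :=
  ∃ ξ : Ω →ₘ[μ] ℝ, 0 ≤ ξ ∧ ∀ x, |u x| ≤ ξ * nrm x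

/-- `s` is the supremum in `L̄⁰(F)` (with the a.e. order) of the set `S` of
(representatives of) extended-real-valued random variables. -/
def IsAESup (μ : Measure Ω) (S : Set (Ω → EReal)) (s : Ω → EReal) : Prop :=
  (∀ g ∈ S, ∀ᵐ ω ∂μ, g ω ≤ s ω) ∧
    ∀ b : Ω → EReal, AEMeasurable b μ → (∀ g ∈ S, ∀ᵐ ω ∂μ, g ω ≤ b ω) →
      ∀ᵐ ω ∂μ, s ω ≤ b ω

/-- `f : E → L̄⁰(F)` (in representative form) is a proper lower semicontinuous `L⁰`-convex
function: a.e.-measurable values, nowhere `-∞`, somewhere finite, `L⁰`-convex, and with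
an epigraph that is (sequentially) closed in the `(ε,λ)`-topology of `E × L⁰(F)`. -/
def IsCvxFn (nrm : E → Ω →ₘ[μ] ℝ) (f : E → Ω → EReal) : Prop :=
  (∀ x, AEMeasurable (f x) μ) ∧
  (∀ x, ∀ᵐ ω ∂μ, ⊥ < f x ω) ∧
  (∃ x, ∀ᵐ ω ∂μ, f x ω < ⊤) ∧
  (∀ ξ : Ω →ₘ[μ] ℝ, 0 ≤ ξ → ξ ≤ 1 → ∀ x y : E,
    ∀ᵐ ω ∂μ, f (ξ • x + (1 - ξ) • y) ω ≤
      ((ξ ω : ℝ) : EReal) * f x ω + (((1 - ξ : Ω →ₘ[μ] ℝ) ω : ℝ) : EReal) * f y ω) ∧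
  (∀ (x : ℕ → E) (r : ℕ → Ω →ₘ[μ] ℝ) (x₀ : E) (r₀ : Ω →ₘ[μ] ℝ),
    (∀ n, ∀ᵐ ω ∂μ, f (x n) ω ≤ ((r n ω : ℝ) : EReal)) →
    Tendsto (fun n => dP μ (nrm (x n - x₀))) atTop (nhds 0) →
    Tendsto (fun n => dP μ (r n - r₀)) atTop (nhds 0) →
    ∀ᵐ ω ∂μ, f x₀ ω ≤ ((r₀ ω : ℝ) : EReal))

/-- The class `𝒞(E)` of proper lower semicontinuous `L⁰`-convex functions on `E`. -/
def CvxFn (nrm : E → Ω →ₘ[μ] ℝ) := {f : E → Ω → EReal // IsCvxFn nrm f}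

/-- The pointwise a.e. order on functions `E → L̄⁰(F)`. -/
def CleFn (μ : Measure Ω) (f g : E → Ω → EReal) : Prop := ∀ x : E, ∀ᵐ ω ∂μ, f x ω ≤ g x ω

/-- Pointwise a.e. equality of functions `E → L̄⁰(F)` (i.e. equality in `L̄⁰`). -/
def CeqFn (μ : Measure Ω) (f g : E → Ω → EReal) : Prop := ∀ x : E, ∀ᵐ ω ∂μ, f x ω = g x ω

/-- `T` is a stable operator on `𝒞(E)`: `T(Ĩ_A f + Ĩ_{A^c} g) = Ĩ_A T(f) + Ĩ_{A^c} T(g)`. -/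
def IsStableOp (nrm : E → Ω →ₘ[μ] ℝ) (T : CvxFn nrm → CvxFn nrm) : Prop :=
  ∀ A : Set Ω, MeasurableSet A → ∀ f g h : CvxFn nrm,
    (∀ x : E, ∀ᵐ ω ∂μ, h.1 x ω = if ω ∈ A then f.1 x ω else g.1 x ω) →
    (∀ x : E, ∀ᵐ ω ∂μ, (T h).1 x ω = if ω ∈ A then (T f).1 x ω else (T g).1 x ω)

/-- `T : 𝒞(E) → 𝒞(E)` is fully order preserving: `f ≤ g ↔ T f ≤ T g`, and `T` is onto
(up to equality in `L̄⁰`, i.e. pointwise a.e. equality). -/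
def IsFullyOrderPreserving (nrm : E → Ω →ₘ[μ] ℝ)
    (T : CvxFn nrm → CvxFn nrm) : Prop :=
  (∀ f g : CvxFn nrm, CleFn μ f.1 g.1 ↔ CleFn μ (T f).1 (T g).1) ∧
    ∀ g : CvxFn nrm, ∃ f : CvxFn nrm, CeqFn μ (T f).1 g.1

end RN

section Helpers

instance instOR : IsOrderedRing (Ω →ₘ[μ] ℝ) where
  add_le_add_left a b h c := by
    rw [← AEEqFun.coeFn_le] at h ⊢
    filter_upwards [h, AEEqFun.coeFn_add a c, AEEqFun.coeFn_add b c] with ω h h1 h2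
    rw [h1, h2]; simpa using h
  zero_le_one := by
    rw [← AEEqFun.coeFn_le]
    filter_upwards [AEEqFun.coeFn_zero (μ := μ) (β := ℝ), AEEqFun.coeFn_one (μ := μ) (β := ℝ)] with ω h1 h2
    rw [h1, h2]; simp
  mul_le_mul_of_nonneg_left a ha b c h := by
    rw [← AEEqFun.coeFn_le] at h ha
    show a * b ≤ a * c
    rw [← AEEqFun.coeFn_le]
    filter_upwards [h, ha, AEEqFun.coeFn_mul a b, AEEqFun.coeFn_mul a c,
      AEEqFun.coeFn_zero (μ := μ) (β := ℝ)] with ω h ha h1 h2 h3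
    rw [h1, h2]
    rw [h3] at ha
    exact mul_le_mul_of_nonneg_left h ha
  mul_le_mul_of_nonneg_right a ha b c h := by
    rw [← AEEqFun.coeFn_le] at h ha
    show b * a ≤ c * a
    rw [← AEEqFun.coeFn_le]
    filter_upwards [h, ha, AEEqFun.coeFn_mul b a, AEEqFun.coeFn_mul c a,
      AEEqFun.coeFn_zero (μ := μ) (β := ℝ)] with ω h ha h1 h2 h3
    rw [h1, h2]
    rw [h3] at ha
    exact mul_le_mul_of_nonneg_right h ha

theorem coe_add' (a b : Ω →ₘ[μ] ℝ) : ∀ᵐ ω ∂μ, (a + b) ω = a ω + b ω := AEEqFun.coeFn_add a b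
theorem coe_sub' (a b : Ω →ₘ[μ] ℝ) : ∀ᵐ ω ∂μ, (a - b) ω = a ω - b ω := AEEqFun.coeFn_sub a b
theorem coe_mul' (a b : Ω →ₘ[μ] ℝ) : ∀ᵐ ω ∂μ, (a * b) ω = a ω * b ω := AEEqFun.coeFn_mul a b
theorem coe_neg' (a : Ω →ₘ[μ] ℝ) : ∀ᵐ ω ∂μ, (-a) ω = -a ω := AEEqFun.coeFn_neg a
theorem coe_abs' (a : Ω →ₘ[μ] ℝ) : ∀ᵐ ω ∂μ, |a| ω = |a ω| := AEEqFun.coeFn_abs a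
theorem coe_inf' (a b : Ω →ₘ[μ] ℝ) : ∀ᵐ ω ∂μ, (a ⊓ b) ω = min (a ω) (b ω) := AEEqFun.coeFn_inf a b
theorem coe_zero' : ∀ᵐ ω ∂μ, (0 : Ω →ₘ[μ] ℝ) ω = 0 := AEEqFun.coeFn_zero
theorem coe_one' : ∀ᵐ ω ∂μ, (1 : Ω →ₘ[μ] ℝ) ω = 1 := AEEqFun.coeFn_one
theorem le_iff' (a b : Ω →ₘ[μ] ℝ) : a ≤ b ↔ ∀ᵐ ω ∂μ, a ω ≤ b ω := AEEqFun.coeFn_le.symm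
theorem eq_iff' (a b : Ω →ₘ[μ] ℝ) : a = b ↔ ∀ᵐ ω ∂μ, a ω = b ω :=
  ⟨fun h => by rw [h]; simp, fun h => AEEqFun.ext h⟩
theorem coe_natCast' (n : ℕ) : ∀ᵐ ω ∂μ, (n : Ω →ₘ[μ] ℝ) ω = n :=
  AEEqFun.coeFn_const Ω (n : ℝ)

theorem arch' (a b : Ω →ₘ[μ] ℝ) (h : ∀ n : ℕ, (n : Ω →ₘ[μ] ℝ) * a ≤ b) : a ≤ 0 := by
  rw [le_iff']
  have h' : ∀ᵐ ω ∂μ, ∀ n : ℕ, (n : ℝ) * a ω ≤ b ω := by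
    rw [ae_all_iff]
    intro n
    have := (le_iff' _ _).1 (h n)
    filter_upwards [this, coe_mul' (n : Ω →ₘ[μ] ℝ) a, coe_natCast' (μ := μ) n] with ω h1 h2 h3
    rwa [h2, h3] at h1
  filter_upwards [h', coe_zero' (μ := μ)] with ω h1 h2
  rw [h2]
  by_contra hc
  push Not at hc
  obtain ⟨n, hn⟩ := exists_nat_gt (b ω / a ω)
  rw [div_lt_iff₀ hc] at hn
  exact absurd (h1 n) (not_le.2 hn)

/-- strictly positive elements -/
def PosR (ξ : Ω →ₘ[μ] ℝ) : Prop := 0 ≤ ξ ∧ ∃ η : Ω →ₘ[μ] ℝ, 0 ≤ η ∧ ξ * η = 1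

theorem posR_of_ae (ξ : Ω →ₘ[μ] ℝ) (h : ∀ᵐ ω ∂μ, 0 < ξ ω) : PosR ξ := by
  refine ⟨(le_iff' _ _).2 ?_, AEEqFun.compMeasurable (fun x : ℝ => x⁻¹) measurable_inv ξ,
    (le_iff' _ _).2 ?_, (eq_iff' _ _).2 ?_⟩
  · filter_upwards [h, coe_zero' (μ := μ)] with ω h1 h2
    rw [h2]; exact h1.le
  · filter_upwards [h, coe_zero' (μ := μ),
      AEEqFun.coeFn_compMeasurable (fun x : ℝ => x⁻¹) measurable_inv ξ] with ω h1 h2 h3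
    rw [h2, h3]; exact (inv_pos.2 h1).le
  · filter_upwards [h, coe_one' (μ := μ),
      coe_mul' ξ (AEEqFun.compMeasurable (fun x : ℝ => x⁻¹) measurable_inv ξ),
      AEEqFun.coeFn_compMeasurable (fun x : ℝ => x⁻¹) measurable_inv ξ] with ω h1 h2 h3 h4
    rw [h2, h3, h4]; exact mul_inv_cancel₀ h1.ne'

theorem PosR.ae {ξ : Ω →ₘ[μ] ℝ} (h : PosR ξ) : ∀ᵐ ω ∂μ, 0 < ξ ω := by
  obtain ⟨h0, η, h1, h2⟩ := h
  filter_upwards [(le_iff' _ _).1 h0, (eq_iff' _ _).1 h2, coe_mul' ξ η, coe_one' (μ := μ),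
    coe_zero' (μ := μ)] with ω a b c d e
  rw [c, d] at b
  rw [e] at a
  rcases a.lt_or_eq with a | a
  · exact a
  · rw [← a] at b; simp at b

theorem PosR.add {ξ η : Ω →ₘ[μ] ℝ} (h : PosR ξ) (h' : 0 ≤ η) : PosR (ξ + η) := by
  apply posR_of_ae
  filter_upwards [h.ae, (le_iff' _ _).1 h', coe_add' ξ η, coe_zero' (μ := μ)] with ω a b c d
  rw [c]; rw [d] at b; linarith

theorem PosR.mul {ξ η : Ω →ₘ[μ] ℝ} (h : PosR ξ) (h' : PosR η) : PosR (ξ * η) := by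
  apply posR_of_ae
  filter_upwards [h.ae, h'.ae, coe_mul' ξ η] with ω a b c
  rw [c]; positivity

theorem PosR.one : PosR (1 : Ω →ₘ[μ] ℝ) := ⟨zero_le_one, 1, zero_le_one, one_mul 1⟩

theorem exists_glb_directed [IsProbabilityMeasure μ] (S : Set (Ω →ₘ[μ] ℝ)) (hne : S.Nonempty)
    (hbd : BddBelow S) (hdir : ∀ a ∈ S, ∀ b ∈ S, ∃ c ∈ S, c ≤ a ∧ c ≤ b) :
    ∃ (m : Ω →ₘ[μ] ℝ) (s : ℕ → Ω →ₘ[μ] ℝ), IsGLB S m ∧ (∀ n, s n ∈ S) ∧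
      ∀ᵐ ω ∂μ, Tendsto (fun n => s n ω) atTop (𝓝 (m ω)) := by
  obtain ⟨b, hb⟩ := hbd
  let ψ : (Ω →ₘ[μ] ℝ) → ℝ := fun ξ => ∫ ω, Real.arctan (ξ ω) ∂μ
  have hint : ∀ ξ : Ω →ₘ[μ] ℝ, Integrable (fun ω => Real.arctan (ξ ω)) μ := by
    intro ξ
    refine Integrable.of_bound (C := Real.pi / 2)
      (Real.continuous_arctan.comp_aestronglyMeasurable ξ.aestronglyMeasurable) ?_
    filter_upwards with ω
    rw [Real.norm_eq_abs, abs_le]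
    exact ⟨(Real.neg_pi_div_two_lt_arctan _).le, (Real.arctan_lt_pi_div_two _).le⟩
  have hmono : ∀ ξ η : Ω →ₘ[μ] ℝ, ξ ≤ η → ψ ξ ≤ ψ η := by
    intro ξ η h
    refine integral_mono_ae (hint ξ) (hint η) ?_
    filter_upwards [(le_iff' _ _).1 h] with ω h
    exact Real.arctan_mono h
  have hlow : BddBelow (ψ '' S) := ⟨ψ b, by
    rintro _ ⟨s, hs, rfl⟩; exact hmono _ _ (hb hs)⟩
  have hneψ : (ψ '' S).Nonempty := hne.image _
  set I := sInf (ψ '' S) with hI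
  have hchoose : ∀ n : ℕ, ∃ s ∈ S, ψ s < I + 1 / ((n : ℝ) + 1) := by
    intro n
    obtain ⟨_, ⟨s, hs, rfl⟩, h⟩ := exists_lt_of_csInf_lt hneψ
      (show sInf (ψ '' S) < I + 1 / ((n : ℝ) + 1) by
        have : 0 < 1 / ((n : ℝ) + 1) := by positivity
        linarith)
    exact ⟨s, hs, h⟩
  choose t htS htψ using hchoose
  choose! d hdS hd1 hd2 using hdir
  let s : ℕ → Ω →ₘ[μ] ℝ := fun n => Nat.rec (t 0) (fun k x => d x (t (k + 1))) n
  have hs0 : s 0 = t 0 := rfl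
  have hs1 : ∀ n, s (n + 1) = d (s n) (t (n + 1)) := fun n => rfl
  have hsS : ∀ n, s n ∈ S := by
    intro n
    induction n with
    | zero => exact htS 0
    | succ k ih => rw [hs1]; exact hdS _ ih _ (htS _)
  have hst : ∀ n, s n ≤ t n := by
    intro n
    cases n with
    | zero => exact le_rfl
    | succ k => rw [hs1]; exact hd2 _ (hsS k) _ (htS _)
  have hanti : ∀ n, s (n + 1) ≤ s n := fun n => by
    rw [hs1]; exact hd1 _ (hsS n) _ (htS _)
  have hae : ∀ᵐ ω ∂μ, (∀ n, s (n + 1) ω ≤ s n ω) ∧ ∀ n, b ω ≤ s n ω := by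
    rw [eventually_and, ae_all_iff, ae_all_iff]
    exact ⟨fun n => (le_iff' _ _).1 (hanti n), fun n => (le_iff' _ _).1 (hb (hsS n))⟩
  have hmm : Measurable (fun ω => ⨅ n, s n ω) := Measurable.iInf fun n => (s n).measurable
  let m : Ω →ₘ[μ] ℝ := AEEqFun.mk (fun ω => ⨅ n, s n ω) hmm.aestronglyMeasurable
  have hm : ∀ᵐ ω ∂μ, m ω = ⨅ n, s n ω := AEEqFun.coeFn_mk _ _
  have htend : ∀ᵐ ω ∂μ, Tendsto (fun n => s n ω) atTop (𝓝 (m ω)) := by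
    filter_upwards [hae, hm] with ω h1 h2
    rw [h2]
    exact tendsto_atTop_ciInf (antitone_nat_of_succ_le h1.1)
      ⟨b ω, by rintro _ ⟨n, rfl⟩; exact h1.2 n⟩
  have hms : ∀ n, m ≤ s n := by
    intro n
    rw [le_iff']
    filter_upwards [hae, hm] with ω h1 h2
    rw [h2]
    exact ciInf_le ⟨b ω, by rintro _ ⟨n, rfl⟩; exact h1.2 n⟩ n
  have hψm : ψ m ≤ I := by
    refine le_of_forall_pos_lt_add fun ε hε => ?_
    obtain ⟨n, hn⟩ := exists_nat_one_div_lt hε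
    calc ψ m ≤ ψ (t n) := hmono _ _ ((hms n).trans (hst n))
      _ < _ := htψ n
      _ < _ := by linarith
  refine ⟨m, s, ⟨?_, ?_⟩, hsS, htend⟩
  · intro a ha
    have key : I ≤ ψ (a ⊓ m) := by
      have ht : Tendsto (fun n => ψ (a ⊓ s n)) atTop (𝓝 (ψ (a ⊓ m))) := by
        refine tendsto_integral_of_dominated_convergence (fun _ => Real.pi / 2)
          (fun n => (hint _).1) (integrable_const _) ?_ ?_
        · intro n
          filter_upwards with ω
          rw [Real.norm_eq_abs, abs_le]
          exact ⟨(Real.neg_pi_div_two_lt_arctan _).le, (Real.arctan_lt_pi_div_two _).le⟩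
        · have h1 : ∀ᵐ ω ∂μ, ∀ n, (a ⊓ s n) ω = min (a ω) (s n ω) := by
            rw [ae_all_iff]; exact fun n => coe_inf' _ _
          filter_upwards [h1, coe_inf' a m, htend] with ω h1 h2 h3
          simp only [h1, h2]
          exact (Real.continuous_arctan.tendsto _).comp (tendsto_const_nhds.min h3)
      refine ge_of_tendsto' ht fun n => ?_
      have h1 : d a (s n) ≤ a ⊓ s n := le_inf (hd1 _ ha _ (hsS n)) (hd2 _ ha _ (hsS n))
      exact (csInf_le hlow ⟨_, hdS _ ha _ (hsS n), rfl⟩).trans (hmono _ _ h1)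
    have h0 : ∫ ω, (Real.arctan (m ω) - Real.arctan ((a ⊓ m) ω)) ∂μ = 0 := by
      rw [integral_sub (hint _) (hint _)]
      have h1 := hmono (a ⊓ m) m inf_le_right
      simp only [ψ] at h1 key hψm
      linarith
    have hnn : 0 ≤ᵐ[μ] fun ω => Real.arctan (m ω) - Real.arctan ((a ⊓ m) ω) := by
      filter_upwards [coe_inf' a m] with ω h2
      show 0 ≤ _
      rw [sub_nonneg, h2]
      exact Real.arctan_mono (min_le_right _ _)
    have h0' := (integral_eq_zero_iff_of_nonneg_ae hnn ((hint _).sub (hint _))).1 h0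
    rw [le_iff']
    filter_upwards [h0', coe_inf' a m] with ω h1 h2
    have h3 : Real.arctan (m ω) = Real.arctan ((a ⊓ m) ω) := by
      have : Real.arctan (m ω) - Real.arctan ((a ⊓ m) ω) = 0 := h1
      linarith
    have h4 := Real.arctan_injective h3
    rw [h2] at h4
    rw [h4]; exact min_le_left _ _
  · intro b' hb'
    rw [le_iff']
    have h1 : ∀ᵐ ω ∂μ, ∀ n, b' ω ≤ s n ω := by
      rw [ae_all_iff]; exact fun n => (le_iff' _ _).1 (hb' (hsS n))
    filter_upwards [h1, hm] with ω h1 h2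
    rw [h2]; exact le_ciInf h1

theorem exists_glb [IsProbabilityMeasure μ] (S : Set (Ω →ₘ[μ] ℝ)) (hne : S.Nonempty)
    (hbd : BddBelow S) : ∃ m, IsGLB S m := by
  obtain ⟨b, hb⟩ := hbd
  have hlb : ∀ b, b ∈ lowerBounds S → b ∈ lowerBounds (infClosure S) := by
    intro b hb
    have : infClosure S ⊆ Set.Ici b :=
      infClosure_min (fun x hx => hb hx) (fun x hx y hy => Set.mem_Ici.2 (le_inf hx hy))
    exact fun x hx => this hx
  obtain ⟨m, -, hm, -⟩ := exists_glb_directed (infClosure S) (hne.mono subset_infClosure)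
    ⟨b, hlb b hb⟩ (fun a ha c hc => ⟨a ⊓ c, infClosed_infClosure ha hc, inf_le_left, inf_le_right⟩)
  exact ⟨m, fun x hx => hm.1 (subset_infClosure hx), fun b hb => hm.2 (hlb b hb)⟩

section HB
variable {E : Type*} [AddCommGroup E] [Module (Ω →ₘ[μ] ℝ) E]

def SubL (q : E → Ω →ₘ[μ] ℝ) : Prop :=
  (∀ x y, q (x + y) ≤ q x + q y) ∧ ∀ ξ : Ω →ₘ[μ] ℝ, PosR ξ → ∀ x, q (ξ • x) ≤ ξ * q x

theorem PosR.le_of_mul_le {ξ a b : Ω →ₘ[μ] ℝ} (h : PosR ξ) (hab : ξ * a ≤ ξ * b) : a ≤ b := by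
  obtain ⟨h0, η, h1, h2⟩ := h
  have := mul_le_mul_of_nonneg_left hab h1
  rwa [← mul_assoc, ← mul_assoc, mul_comm η, h2, one_mul, one_mul] at this

theorem SubL.hom {q : E → Ω →ₘ[μ] ℝ} (h : SubL q) {ξ : Ω →ₘ[μ] ℝ} (hξ : PosR ξ) (x : E) :
    q (ξ • x) = ξ * q x := by
  refine le_antisymm (h.2 ξ hξ x) ?_
  obtain ⟨h0, η, h1, h2⟩ := hξ
  have h3 := h.2 η ⟨h1, ξ, h0, by rw [mul_comm, h2]⟩ (ξ • x)
  rw [smul_smul, mul_comm η, h2, one_smul] at h3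
  have := mul_le_mul_of_nonneg_left h3 h0
  rwa [← mul_assoc, h2, one_mul] at this

theorem SubL.zero {q : E → Ω →ₘ[μ] ℝ} (h : SubL q) : q 0 = 0 := by
  have h1 := h.hom (PosR.one.add zero_le_one) (0 : E)
  rw [smul_zero] at h1
  have h2 : (1 + 1) * q 0 = q 0 + q 0 := by ring
  rw [h2] at h1
  exact left_eq_add.1 h1

theorem SubL.neg_le {q : E → Ω →ₘ[μ] ℝ} (h : SubL q) (x : E) : - q (-x) ≤ q x := by
  have := h.1 x (-x)
  rw [add_neg_cancel, h.zero] at this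
  rwa [neg_le_iff_add_nonneg]

theorem SubL.chain [IsProbabilityMeasure μ] {p : E → Ω →ₘ[μ] ℝ} (C : Set (E → Ω →ₘ[μ] ℝ))
    (hC : ∀ q ∈ C, SubL q ∧ q ≤ p) (hch : IsChain (· ≤ ·) C) (hne : C.Nonempty) :
    ∃ q, SubL q ∧ q ≤ p ∧ ∀ z ∈ C, q ≤ z := by
  have hg : ∀ x, ∃ m, IsGLB ((fun q : E → Ω →ₘ[μ] ℝ => q x) '' C) m := by
    intro x
    refine exists_glb _ (hne.image _) ⟨- p (-x), ?_⟩
    rintro _ ⟨q, hq, rfl⟩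
    exact (neg_le_neg ((hC q hq).2 (-x))).trans ((hC q hq).1.neg_le x)
  choose m hm using hg
  have hmz : ∀ z ∈ C, m ≤ z := fun z hz x => (hm x).1 ⟨z, hz, rfl⟩
  refine ⟨m, ⟨?_, ?_⟩, ?_, hmz⟩
  · intro x y
    have key : ∀ q1 ∈ C, ∀ q2 ∈ C, m (x + y) ≤ q1 x + q2 y := by
      intro q1 h1 q2 h2
      rcases hch.total h1 h2 with h | h
      · exact (hmz q1 h1 _).trans (((hC q1 h1).1.1 x y).trans (add_le_add le_rfl (h y)))
      · exact (hmz q2 h2 _).trans (((hC q2 h2).1.1 x y).trans (add_le_add (h x) le_rfl))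
    have k2 : ∀ q1 ∈ C, m (x + y) - q1 x ≤ m y := by
      intro q1 h1
      apply (hm y).2
      rintro _ ⟨q2, h2, rfl⟩
      exact sub_le_iff_le_add'.2 (key q1 h1 q2 h2)
    have k3 : m (x + y) - m y ≤ m x := by
      apply (hm x).2
      rintro _ ⟨q1, h1, rfl⟩
      have := k2 q1 h1
      exact sub_le_iff_le_add.2 (sub_le_iff_le_add'.1 this)
    exact sub_le_iff_le_add.1 k3
  · intro ξ hξ x
    obtain ⟨h0, η, h1, h2⟩ := id hξ
    have k : η * m (ξ • x) ≤ m x := by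
      apply (hm x).2
      rintro _ ⟨q, hq, rfl⟩
      have := mul_le_mul_of_nonneg_left ((hmz q hq (ξ • x)).trans ((hC q hq).1.2 ξ hξ x)) h1
      rwa [← mul_assoc, mul_comm η ξ, h2, one_mul] at this
    have := mul_le_mul_of_nonneg_left k h0
    rwa [← mul_assoc, h2, one_mul] at this
  · obtain ⟨q, hq⟩ := hne
    exact (hmz q hq).trans (hC q hq).2

theorem SubL.shrink [IsProbabilityMeasure μ] {q : E → Ω →ₘ[μ] ℝ} (h : SubL q) (y : E) :
    ∃ r, SubL r ∧ r ≤ q ∧ ∀ x, r x ≤ q (x + y) - q y := by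
  have hg : ∀ x, ∃ m, IsGLB {a | ∃ t : Ω →ₘ[μ] ℝ, PosR t ∧ a = q (x + t • y) - t * q y} m := by
    intro x
    refine exists_glb _ ⟨_, 1, PosR.one, rfl⟩ ⟨- q (-x), ?_⟩
    rintro _ ⟨t, ht, rfl⟩
    have := h.1 (x + t • y) (-x)
    rw [show x + t • y + -x = t • y by abel, h.hom ht] at this
    rw [neg_le_iff_add_nonneg]
    have h2 := sub_nonneg.2 this
    calc (0 : Ω →ₘ[μ] ℝ) ≤ _ := h2
      _ = _ := by ring
  choose m hm using hg
  have hmt : ∀ x t, PosR t → m x ≤ q (x + t • y) - t * q y := fun x t ht => (hm x).1 ⟨t, ht, rfl⟩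
  refine ⟨m, ⟨?_, ?_⟩, ?_, ?_⟩
  · intro x z
    have key : ∀ t, PosR t → ∀ s, PosR s →
        m (x + z) ≤ (q (x + t • y) - t * q y) + (q (z + s • y) - s * q y) := by
      intro t ht s hs
      refine (hmt (x + z) (t + s) (ht.add hs.1)).trans ?_
      have := h.1 (x + t • y) (z + s • y)
      rw [show x + t • y + (z + s • y) = x + z + (t + s) • y by rw [add_smul]; abel] at this
      have h2 := sub_le_sub_right this ((t + s) * q y)
      refine h2.trans (le_of_eq (by ring))
    have k2 : ∀ t, PosR t → m (x + z) - (q (x + t • y) - t * q y) ≤ m z := by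
      intro t ht
      apply (hm z).2
      rintro _ ⟨s, hs, rfl⟩
      exact sub_le_iff_le_add'.2 (key t ht s hs)
    have k3 : m (x + z) - m z ≤ m x := by
      apply (hm x).2
      rintro _ ⟨t, ht, rfl⟩
      have := k2 t ht
      exact sub_le_iff_le_add.2 (sub_le_iff_le_add'.1 this)
    exact sub_le_iff_le_add.1 k3
  · intro ξ hξ x
    obtain ⟨h0, η, h1, h2⟩ := id hξ
    have k : η * m (ξ • x) ≤ m x := by
      apply (hm x).2
      rintro _ ⟨t, ht, rfl⟩
      have h3 := hmt (ξ • x) (ξ * t) (hξ.mul ht)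
      rw [mul_smul, ← smul_add, h.hom hξ] at h3
      have := mul_le_mul_of_nonneg_left h3 h1
      refine this.trans (le_of_eq ?_)
      calc _ = (ξ * η) * (q (x + t • y) - t * q y) := by ring
        _ = _ := by rw [h2, one_mul]
    have := mul_le_mul_of_nonneg_left k h0
    rwa [← mul_assoc, h2, one_mul] at this
  · intro x
    refine (hmt x 1 PosR.one).trans ?_
    rw [one_smul, one_mul, sub_le_iff_le_add]
    exact h.1 x y
  · intro x
    simpa using hmt x 1 PosR.one

theorem posPart_posR (ξ : Ω →ₘ[μ] ℝ) : ∃ a b : Ω →ₘ[μ] ℝ, PosR a ∧ PosR b ∧ ξ = a - b := by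
  have h : (0 : Ω →ₘ[μ] ℝ) ≤ |ξ| := abs_nonneg ξ
  refine ⟨1 + (ξ + |ξ|), 1 + |ξ|, PosR.one.add ?_, PosR.one.add h, by ring⟩
  exact neg_le_iff_add_nonneg'.1 (neg_le_abs ξ)

theorem SubL.hahn_banach [IsProbabilityMeasure μ] {p : E → Ω →ₘ[μ] ℝ} (h : SubL p) :
    ∃ v : E →ₗ[Ω →ₘ[μ] ℝ] (Ω →ₘ[μ] ℝ), ∀ x, v x ≤ p x := by
  obtain ⟨q, hqp, hq⟩ := zorn_le_nonempty₀ (α := (E → Ω →ₘ[μ] ℝ)ᵒᵈ)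
    {q | SubL (OrderDual.ofDual q) ∧ OrderDual.ofDual q ≤ p} (by
      intro C hC hch z hz
      obtain ⟨r, h1, h2, h3⟩ := SubL.chain (p := p) C hC hch.symm ⟨z, hz⟩
      exact ⟨OrderDual.toDual r, ⟨h1, h2⟩, h3⟩) (OrderDual.toDual p) ⟨h, le_rfl⟩
  have hmin : ∀ r, SubL r → r ≤ OrderDual.ofDual q → OrderDual.ofDual q ≤ r := by
    intro r hr hrq
    exact hq.2 (y := OrderDual.toDual r) ⟨hr, hrq.trans hq.1.2⟩ hrq
  have hq1 : SubL (OrderDual.ofDual q) ∧ OrderDual.ofDual q ≤ p := hq.1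
  generalize OrderDual.ofDual q = q' at hmin hq1
  obtain ⟨hs, hp⟩ := hq1
  have hadd : ∀ x y, q' (x + y) = q' x + q' y := by
    intro x y
    refine le_antisymm (hs.1 x y) ?_
    obtain ⟨r, h1, h2, h3⟩ := hs.shrink y
    have := (hmin r h1 h2 x).trans (h3 x)
    exact le_sub_iff_add_le.1 this
  have hsub : ∀ x y, q' (x - y) = q' x - q' y := by
    intro x y
    rw [eq_sub_iff_add_eq, ← hadd, sub_add_cancel]
  refine ⟨{ toFun := q', map_add' := hadd, map_smul' := ?_ }, fun x => hp x⟩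
  intro ξ x
  obtain ⟨a, b, ha, hb, rfl⟩ := posPart_posR ξ
  rw [sub_smul, hsub, hs.hom ha, hs.hom hb]
  simp only [RingHom.id_apply, smul_eq_mul, sub_mul]

end HB

section Main
variable {E : Type*} [AddCommGroup E] [Module (Ω →ₘ[μ] ℝ) E]

theorem ind_exists (A : Set Ω) (hA : NullMeasurableSet A μ) :
    ∃ ξ : Ω →ₘ[μ] ℝ, 0 ≤ ξ ∧ ξ ≤ 1 ∧ ∀ᵐ ω ∂μ, ξ ω = if ω ∈ A then 1 else 0 := by
  have hm : AEStronglyMeasurable (A.indicator (fun _ => (1 : ℝ))) μ :=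
    (aestronglyMeasurable_const.indicator₀ hA)
  have hc : ∀ᵐ ω ∂μ, (AEEqFun.mk _ hm : Ω →ₘ[μ] ℝ) ω = if ω ∈ A then 1 else 0 := by
    filter_upwards [AEEqFun.coeFn_mk _ hm] with ω h
    rw [h, Set.indicator_apply]
  refine ⟨AEEqFun.mk _ hm, (le_iff' _ _).2 ?_, (le_iff' _ _).2 ?_, hc⟩
  · filter_upwards [hc, coe_zero' (μ := μ)] with ω h1 h2
    rw [h1, h2]; split_ifs <;> norm_num
  · filter_upwards [hc, coe_one' (μ := μ)] with ω h1 h2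
    rw [h1, h2]; split_ifs <;> norm_num

theorem mix_exists (a b : Ω →ₘ[μ] ℝ) : ∃ ξ : Ω →ₘ[μ] ℝ, 0 ≤ ξ ∧ ξ ≤ 1 ∧
    ξ * a + (1 - ξ) * b ≤ a ∧ ξ * a + (1 - ξ) * b ≤ b := by
  obtain ⟨ξ, h0, h1, hξ⟩ := ind_exists (μ := μ) {ω | a ω ≤ b ω}
    (measurableSet_le a.measurable b.measurable).nullMeasurableSet
  refine ⟨ξ, h0, h1, ?_⟩
  rw [le_iff', le_iff', ← eventually_and]
  filter_upwards [hξ, coe_add' (ξ * a) ((1 - ξ) * b), coe_mul' ξ a, coe_mul' (1 - ξ) b,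
    coe_sub' 1 ξ, coe_one' (μ := μ)] with ω e1 e2 e3 e4 e5 e6
  rw [e2, e3, e4, e5, e6, e1]
  by_cases h : a ω ≤ b ω
  · simp [h]
  · simp [h, (not_le.1 h).le]

variable {nrm : E → Ω →ₘ[μ] ℝ}

theorem IsRNNorm.smul_nonneg (h : IsRNNorm nrm) {ξ : Ω →ₘ[μ] ℝ} (hξ : 0 ≤ ξ) (x : E) :
    nrm (ξ • x) = ξ * nrm x := by
  rw [h.2.1, abs_of_nonneg hξ]

theorem IsRNNorm.zero (h : IsRNNorm nrm) : nrm 0 = 0 := by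
  have := h.smul_nonneg (le_refl (0 : Ω →ₘ[μ] ℝ)) 0
  rwa [zero_smul, zero_mul] at this

theorem IsRNNorm.neg (h : IsRNNorm nrm) (x : E) : nrm (-x) = nrm x := by
  have := h.2.1 (-1) x
  rwa [neg_smul, one_smul, abs_neg, abs_of_nonneg zero_le_one, one_mul] at this

theorem mulle {a b c : Ω →ₘ[μ] ℝ} (h : b ≤ c) (ha : 0 ≤ a) : a * b ≤ a * c :=
  mul_le_mul_of_nonneg_left h ha

theorem sep_exists [IsProbabilityMeasure μ] (hn : IsRNNorm nrm) (C : E → (Ω →ₘ[μ] ℝ) → Prop)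
    (hne : ∃ y r, C y r)
    (hcv : ∀ ξ : Ω →ₘ[μ] ℝ, 0 ≤ ξ → ξ ≤ 1 → ∀ y r z s, C y r → C z s →
      C (ξ • y + (1 - ξ) • z) (ξ * r + (1 - ξ) * s)) (x₀ : E) (c : Ω →ₘ[μ] ℝ)
    (hc : ∀ y r, C y r → c ≤ r + nrm (x₀ - y)) :
    ∃ v : E →ₗ[Ω →ₘ[μ] ℝ] (Ω →ₘ[μ] ℝ), IsBoundedLF nrm v ∧ ∀ y r, C y r → v (y - x₀) + c ≤ r := by
  have hg : ∀ x, ∃ m, IsGLB {a | ∃ (t : Ω →ₘ[μ] ℝ) (y : E) (r : Ω →ₘ[μ] ℝ), PosR t ∧ C y r ∧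
      a = t * (r - c) + nrm (x + t • (x₀ - y))} m := by
    intro x
    obtain ⟨y, r, hyr⟩ := hne
    refine exists_glb _ ⟨_, 1, y, r, PosR.one, hyr, rfl⟩ ⟨- nrm x, ?_⟩
    rintro _ ⟨t, y, r, ht, hyr, rfl⟩
    have h1 := mulle (hc y r hyr) ht.1
    have h2 := hn.2.2.1 (x + t • (x₀ - y)) (-x)
    rw [show x + t • (x₀ - y) + -x = t • (x₀ - y) by abel, hn.neg, hn.smul_nonneg ht.1] at h2
    rw [← sub_nonneg] at h1 h2 ⊢
    calc (0 : Ω →ₘ[μ] ℝ) ≤ _ := add_nonneg h1 h2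
      _ = _ := by ring
  choose P hP using hg
  have hPt : ∀ x t y r, PosR t → C y r → P x ≤ t * (r - c) + nrm (x + t • (x₀ - y)) :=
    fun x t y r ht h => (hP x).1 ⟨t, y, r, ht, h, rfl⟩
  have hsub : SubL P := by
    constructor
    · intro x z
      have key : ∀ t y r, PosR t → C y r → ∀ t' y' r', PosR t' → C y' r' →
          P (x + z) ≤ (t * (r - c) + nrm (x + t • (x₀ - y))) +
            (t' * (r' - c) + nrm (z + t' • (x₀ - y'))) := by
        intro t y r ht hy t' y' r' ht' hy'
        have hT := ht.add ht'.1
        obtain ⟨hT0, η, hη, hTη⟩ := id hT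
        have e1 : 1 - t * η = t' * η := by rw [← hTη]; ring
        have hle : t * η ≤ 1 := by
          rw [← sub_nonneg, e1]; exact mul_nonneg ht'.1 hη
        have hC := hcv (t * η) (mul_nonneg ht.1 hη) hle y r y' r' hy hy'
        rw [e1] at hC
        refine (hPt (x + z) (t + t') _ _ hT hC).trans ?_
        have e2 : (t + t') * (t * η * r + t' * η * r' - c) = t * (r - c) + t' * (r' - c) := by
          calc _ = ((t + t') * η) * (t * r + t' * r') - (t + t') * c := by ring
            _ = _ := by rw [hTη]; ring
        have e3 : x + z + (t + t') • (x₀ - ((t * η) • y + (t' * η) • y')) =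
            (x + t • (x₀ - y)) + (z + t' • (x₀ - y')) := by
          rw [smul_sub, smul_add, smul_smul, smul_smul,
            show (t + t') * (t * η) = ((t + t') * η) * t by ring,
            show (t + t') * (t' * η) = ((t + t') * η) * t' by ring, hTη, one_mul, one_mul,
            smul_sub, smul_sub, add_smul]
          abel
        rw [e2, e3]
        refine (add_le_add le_rfl (hn.2.2.1 _ _)).trans (le_of_eq (by ring))
      have k2 : ∀ t y r, PosR t → C y r →
          P (x + z) - (t * (r - c) + nrm (x + t • (x₀ - y))) ≤ P z := by
        intro t y r ht hy
        apply (hP z).2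
        rintro _ ⟨t', y', r', ht', hy', rfl⟩
        exact sub_le_iff_le_add'.2 (key t y r ht hy t' y' r' ht' hy')
      have k3 : P (x + z) - P z ≤ P x := by
        apply (hP x).2
        rintro _ ⟨t, y, r, ht, hy, rfl⟩
        exact sub_le_iff_le_add.2 (sub_le_iff_le_add'.1 (k2 t y r ht hy))
      exact sub_le_iff_le_add.1 k3
    · intro ξ hξ x
      obtain ⟨h0, η, h1, h2⟩ := id hξ
      have k : η * P (ξ • x) ≤ P x := by
        apply (hP x).2
        rintro _ ⟨t, y, r, ht, hy, rfl⟩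
        have h3 := hPt (ξ • x) (ξ * t) y r (hξ.mul ht) hy
        rw [mul_smul, ← smul_add, hn.smul_nonneg h0] at h3
        refine (mulle h3 h1).trans (le_of_eq ?_)
        calc _ = (ξ * η) * (t * (r - c) + nrm (x + t • (x₀ - y))) := by ring
          _ = _ := by rw [h2, one_mul]
      have := mulle k h0
      rwa [← mul_assoc, h2, one_mul] at this
  obtain ⟨v, hv⟩ := hsub.hahn_banach
  have hvn : ∀ x, v x ≤ nrm x := by
    intro x
    obtain ⟨y, r, hyr⟩ := hne
    rw [← sub_nonpos]
    have hK : 0 ≤ (r - c) + nrm (x₀ - y) := by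
      have := sub_nonneg.2 (hc y r hyr)
      calc (0 : Ω →ₘ[μ] ℝ) ≤ _ := this
        _ = _ := by ring
    refine arch' _ ((r - c) + nrm (x₀ - y)) fun n => ?_
    have hn0 : (0 : Ω →ₘ[μ] ℝ) ≤ n := Nat.cast_nonneg n
    rcases Nat.eq_zero_or_pos n with rfl | hnpos
    · simpa using hK
    have hnP : PosR (n : Ω →ₘ[μ] ℝ) := by
      apply posR_of_ae
      filter_upwards [coe_natCast' (μ := μ) n] with ω h
      rw [h]; exact_mod_cast hnpos
    obtain ⟨-, η, h1, h2⟩ := hnP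
    have hη : PosR η := ⟨h1, n, hn0, by rw [mul_comm, h2]⟩
    have h3 := (hv x).trans (hPt x η y r hη hyr)
    have h4 := hn.2.2.1 x (η • (x₀ - y))
    rw [hn.smul_nonneg h1] at h4
    have h5 := mulle (h3.trans (add_le_add le_rfl h4)) hn0
    rw [← sub_nonneg] at h5 ⊢
    refine h5.trans (le_of_eq ?_)
    calc _ = (n * η) * (r - c) + (n * η) * nrm (x₀ - y) - n * (v x - nrm x) := by ring
      _ = _ := by rw [h2]; ring
  refine ⟨v, ⟨1, zero_le_one, fun x => ?_⟩, fun y r hyr => ?_⟩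
  · rw [one_mul]
    refine abs_le'.2 ⟨hvn x, ?_⟩
    have := hvn (-x)
    rwa [map_neg, hn.neg] at this
  · have h1 := (hv (y - x₀)).trans (hPt (y - x₀) 1 y r PosR.one hyr)
    rw [one_smul, one_mul, show y - x₀ + (x₀ - y) = 0 by abel, hn.zero, add_zero] at h1
    exact le_sub_iff_add_le.1 h1

theorem dP_mono {a b : Ω →ₘ[μ] ℝ} (h0 : 0 ≤ a) (h : a ≤ b) : dP μ a ≤ dP μ b := by
  refine lintegral_mono_ae ?_
  filter_upwards [(le_iff' _ _).1 h0, (le_iff' _ _).1 h, coe_zero' (μ := μ)] with ω h1 h2 h3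
  rw [h3] at h1
  refine ENNReal.ofReal_le_ofReal (min_le_min ?_ le_rfl)
  rw [abs_of_nonneg h1, abs_of_nonneg (h1.trans h2)]
  exact h2

theorem dP_tendsto [IsProbabilityMeasure μ] (s : ℕ → Ω →ₘ[μ] ℝ)
    (h : ∀ᵐ ω ∂μ, Tendsto (fun n => s n ω) atTop (𝓝 0)) :
    Tendsto (fun n => dP μ (s n)) atTop (𝓝 0) := by
  have : Tendsto (fun n => dP μ (s n)) atTop (𝓝 (∫⁻ _, 0 ∂μ)) := by
    refine tendsto_lintegral_of_dominated_convergence' (fun _ => 1) (fun n => ?_)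
      (fun n => ?_) (by simp) ?_
    · have := (s n).measurable
      fun_prop
    · filter_upwards with ω
      exact (ENNReal.ofReal_le_ofReal (min_le_right _ _)).trans (by simp)
    · filter_upwards [h] with ω h
      have h2 : Continuous (fun x : ℝ => ENNReal.ofReal (min |x| 1)) :=
        ENNReal.continuous_ofReal.comp (by fun_prop)
      have h3 := (h2.tendsto 0).comp h
      have e : ENNReal.ofReal (min |(0 : ℝ)| 1) = 0 := by simp
      rw [e] at h3
      exact h3
  simpa using this

theorem mem_of_only_trivial [IsProbabilityMeasure μ] (hn : IsRNNorm nrm)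
    (C : E → (Ω →ₘ[μ] ℝ) → Prop)
    (hne : ∃ y r, C y r)
    (hcv : ∀ ξ : Ω →ₘ[μ] ℝ, 0 ≤ ξ → ξ ≤ 1 → ∀ y r z s, C y r → C z s →
      C (ξ • y + (1 - ξ) • z) (ξ * r + (1 - ξ) * s))
    (hcl : ∀ (x : ℕ → E) (r : ℕ → Ω →ₘ[μ] ℝ) (x₀ : E), (∀ n, C (x n) (r n)) →
      (∀ᵐ ω ∂μ, Tendsto (fun n => nrm (x n - x₀) ω) atTop (𝓝 0)) →
      (∀ᵐ ω ∂μ, Tendsto (fun n => r n ω) atTop (𝓝 0)) → C x₀ 0)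
    (hpos : ∀ y r, C y r → 0 ≤ r)
    (htriv : ∀ v : E →ₗ[Ω →ₘ[μ] ℝ] (Ω →ₘ[μ] ℝ), IsBoundedLF nrm v → ∀ m : Ω →ₘ[μ] ℝ,
      (∀ y r, C y r → v y + m ≤ r) → v = 0 ∧ m ≤ 0) (x₀ : E) : C x₀ 0 := by
  obtain ⟨c, s, hc, hs, hlim⟩ := exists_glb_directed
    {a : Ω →ₘ[μ] ℝ | ∃ y r, C y r ∧ a = r + nrm (x₀ - y)}
    (by obtain ⟨y, r, h⟩ := hne; exact ⟨_, y, r, h, rfl⟩)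
    ⟨0, by rintro _ ⟨y, r, h, rfl⟩; exact add_nonneg (hpos y r h) (hn.1 _)⟩
    (by
      rintro _ ⟨y, r, h, rfl⟩ _ ⟨y', r', h', rfl⟩
      obtain ⟨ξ, h0, h1, ha, hb⟩ := mix_exists (r + nrm (x₀ - y)) (r' + nrm (x₀ - y'))
      have h1' : 0 ≤ 1 - ξ := sub_nonneg.2 h1
      have key : (ξ * r + (1 - ξ) * r') + nrm (x₀ - (ξ • y + (1 - ξ) • y')) ≤
          ξ * (r + nrm (x₀ - y)) + (1 - ξ) * (r' + nrm (x₀ - y')) := by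
        have e : x₀ - (ξ • y + (1 - ξ) • y') = ξ • (x₀ - y) + (1 - ξ) • (x₀ - y') := by
          rw [smul_sub, smul_sub, sub_smul, sub_smul, one_smul, one_smul]; abel
        have := hn.2.2.1 (ξ • (x₀ - y)) ((1 - ξ) • (x₀ - y'))
        rw [hn.smul_nonneg h0, hn.smul_nonneg h1', ← e] at this
        exact (add_le_add le_rfl this).trans (le_of_eq (by ring))
      exact ⟨_, ⟨_, _, hcv ξ h0 h1 y r y' r' h h', rfl⟩, key.trans ha, key.trans hb⟩)
  have hc0 : 0 ≤ c := hc.2 (by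
    rintro _ ⟨y, r, h, rfl⟩; exact add_nonneg (hpos y r h) (hn.1 _))
  obtain ⟨v, hvb, hv⟩ := sep_exists hn C hne hcv x₀ c (fun y r h => hc.1 ⟨y, r, h, rfl⟩)
  obtain ⟨hv0, hm⟩ := htriv v hvb (c - v x₀) (fun y r h => by
    have := hv y r h
    rw [map_sub] at this
    refine (le_of_eq (by ring)).trans this)
  rw [hv0] at hm
  have hc00 : c = 0 := le_antisymm (by simpa using hm) hc0
  rw [hc00] at hlim
  choose y r hC hsr using hs
  have hae : ∀ᵐ ω ∂μ, ∀ n, s n ω = r n ω + nrm (y n - x₀) ω ∧ 0 ≤ r n ω ∧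
      0 ≤ nrm (y n - x₀) ω := by
    rw [ae_all_iff]
    intro n
    have h1 := hsr n
    rw [← hn.neg, neg_sub] at h1
    filter_upwards [(eq_iff' _ _).1 h1, coe_add' (r n) (nrm (y n - x₀)),
      (le_iff' _ _).1 (hpos _ _ (hC n)), (le_iff' _ _).1 (hn.1 (y n - x₀)),
      coe_zero' (μ := μ)] with ω a b c d e
    rw [e] at c d
    exact ⟨a.trans b, c, d⟩
  refine hcl y r x₀ hC ?_ ?_
  · filter_upwards [hlim, hae, coe_zero' (μ := μ)] with ω h1 h2 h3
    rw [h3] at h1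
    refine squeeze_zero (fun n => (h2 n).2.2) (fun n => ?_) h1
    have := h2 n
    linarith [this.1, this.2.1]
  · filter_upwards [hlim, hae, coe_zero' (μ := μ)] with ω h1 h2 h3
    rw [h3] at h1
    refine squeeze_zero (fun n => (h2 n).2.1) (fun n => ?_) h1
    have := h2 n
    linarith [this.1, this.2.2]

theorem minorant_unique {u w : E →ₗ[Ω →ₘ[μ] ℝ] (Ω →ₘ[μ] ℝ)} {α β : Ω →ₘ[μ] ℝ}
    (h : ∀ x, w x + β ≤ u x + α) : w = u ∧ β ≤ α := by
  have h1 : ∀ x, w x - u x ≤ 0 := by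
    intro x
    refine arch' _ (α - β) fun n => ?_
    have := h ((n : Ω →ₘ[μ] ℝ) • x)
    rw [map_smul, map_smul, smul_eq_mul, smul_eq_mul] at this
    rw [← sub_nonneg] at this ⊢
    exact this.trans (le_of_eq (by ring))
  constructor
  · ext1 x
    refine le_antisymm (sub_nonpos.1 (h1 x)) ?_
    have := h1 (-x)
    rw [map_neg, map_neg] at this
    rw [← sub_nonpos]
    exact (le_of_eq (by ring)).trans this
  · have := h 0
    simpa using this

end Main
end Helpers

/-- **Characterization of `L⁰`-affine functions via their affine minorants.**
`f ∈ 𝒞(E)` is `L⁰`-affine iff there is a unique pair `(u, α) ∈ E* × L⁰(F)` such that the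
set of `L⁰`-affine minorants of `f` is exactly `{h_{u,β} : β ≤ α}`. -/
theorem affine_iff_unique_minorant_family
    {Ω : Type*} [MeasurableSpace Ω] {μ : Measure Ω} [IsProbabilityMeasure μ]
    {E : Type*} [AddCommGroup E] [Module (Ω →ₘ[μ] ℝ) E]
    (nrm : E → Ω →ₘ[μ] ℝ) (hnrm : IsRNNorm nrm)
    (hcomplete : IsCompleteRN nrm) (hfull : HasFullSupport nrm)
    (f : E → Ω → EReal) (hf : IsCvxFn nrm f) :
    (∃ (u : E →ₗ[Ω →ₘ[μ] ℝ] (Ω →ₘ[μ] ℝ)), IsBoundedLF nrm u ∧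
        ∃ α : Ω →ₘ[μ] ℝ, ∀ x : E, ∀ᵐ ω ∂μ, f x ω = (((u x + α) ω : ℝ) : EReal)) ↔
      (∃! p : (E →ₗ[Ω →ₘ[μ] ℝ] (Ω →ₘ[μ] ℝ)) × (Ω →ₘ[μ] ℝ),
        IsBoundedLF nrm p.1 ∧
        {q : (E →ₗ[Ω →ₘ[μ] ℝ] (Ω →ₘ[μ] ℝ)) × (Ω →ₘ[μ] ℝ) |
            IsBoundedLF nrm q.1 ∧
              ∀ x : E, ∀ᵐ ω ∂μ, (((q.1 x + q.2) ω : ℝ) : EReal) ≤ f x ω}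
          = {q | q.1 = p.1 ∧ q.2 ≤ p.2}) := by
  constructor
  · rintro ⟨u, hu, α, hfu⟩
    have hset : {q : (E →ₗ[Ω →ₘ[μ] ℝ] (Ω →ₘ[μ] ℝ)) × (Ω →ₘ[μ] ℝ) |
            IsBoundedLF nrm q.1 ∧
              ∀ x : E, ∀ᵐ ω ∂μ, (((q.1 x + q.2) ω : ℝ) : EReal) ≤ f x ω}
          = {q | q.1 = u ∧ q.2 ≤ α} := by
      ext ⟨w, β⟩
      constructor
      · rintro ⟨_, h2⟩
        refine minorant_unique fun x => (le_iff' _ _).2 ?_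
        filter_upwards [h2 x, hfu x] with ω a b
        rw [b] at a
        exact EReal.coe_le_coe_iff.1 a
      · rintro ⟨h1, h2⟩
        dsimp only at h1 h2
        subst h1
        refine ⟨hu, fun x => ?_⟩
        filter_upwards [(le_iff' _ _).1 (add_le_add (le_refl (w x)) h2), hfu x] with ω a b
        rw [b]
        exact EReal.coe_le_coe_iff.2 a
    refine ⟨(u, α), ⟨hu, hset⟩, ?_⟩
    rintro ⟨w, β⟩ ⟨_, h2⟩
    rw [hset] at h2
    have a1 : ((w, β) : (E →ₗ[Ω →ₘ[μ] ℝ] (Ω →ₘ[μ] ℝ)) × (Ω →ₘ[μ] ℝ)) ∈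
        {q : (E →ₗ[Ω →ₘ[μ] ℝ] (Ω →ₘ[μ] ℝ)) × (Ω →ₘ[μ] ℝ) | q.1 = u ∧ q.2 ≤ α} := by
      rw [h2]; exact ⟨rfl, le_rfl⟩
    have a2 : ((u, α) : (E →ₗ[Ω →ₘ[μ] ℝ] (Ω →ₘ[μ] ℝ)) × (Ω →ₘ[μ] ℝ)) ∈
        {q : (E →ₗ[Ω →ₘ[μ] ℝ] (Ω →ₘ[μ] ℝ)) × (Ω →ₘ[μ] ℝ) | q.1 = w ∧ q.2 ≤ β} := by
      rw [← h2]; exact ⟨rfl, le_rfl⟩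
    exact Prod.ext a1.1 (le_antisymm a1.2 a2.2)
  · rintro ⟨⟨u, α⟩, ⟨hu, hset⟩, -⟩
    dsimp only at hu hset
    obtain ⟨hmeas, hbot, ⟨x₁, hx₁⟩, hconv, hclosed⟩ := hf
    have hmin : ∀ x : E, ∀ᵐ ω ∂μ, (((u x + α) ω : ℝ) : EReal) ≤ f x ω := by
      have : ((u, α) : (E →ₗ[Ω →ₘ[μ] ℝ] (Ω →ₘ[μ] ℝ)) × (Ω →ₘ[μ] ℝ)) ∈
        {q : (E →ₗ[Ω →ₘ[μ] ℝ] (Ω →ₘ[μ] ℝ)) × (Ω →ₘ[μ] ℝ) | q.1 = u ∧ q.2 ≤ α} := ⟨rfl, le_rfl⟩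
      rw [← hset] at this
      exact this.2
    let C : E → (Ω →ₘ[μ] ℝ) → Prop := fun y r => ∀ᵐ ω ∂μ, f y ω ≤ (((r + (u y + α)) ω : ℝ) : EReal)
    -- an auxiliary element of `C`
    have hmk : ∀ (y : E) (g : Ω → EReal), AEMeasurable g μ → (∀ᵐ ω ∂μ, f y ω ≤ g ω) →
        (∀ᵐ ω ∂μ, g ω < ⊤) → ∃ r, C y r ∧ ∀ᵐ ω ∂μ, g ω = ((r ω + u y ω + α ω : ℝ) : EReal) := by
      intro y g hg hfg hgt
      have hgm : AEStronglyMeasurable (fun ω => (g ω).toReal) μ :=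
        (measurable_ereal_toReal.comp_aemeasurable hg).aestronglyMeasurable
      have hval : ∀ᵐ ω ∂μ, ∀ t : ℝ, t = (g ω).toReal → g ω = t := by
        filter_upwards [hfg, hgt, hbot y] with ω h1 h2 h3 t ht
        rw [ht, EReal.coe_toReal h2.ne (h3.trans_le h1).ne']
      refine ⟨AEEqFun.mk _ hgm - (u y + α), ?_, ?_⟩
      · show ∀ᵐ ω ∂μ, _
        rw [sub_add_cancel]
        filter_upwards [hfg, hval, AEEqFun.coeFn_mk _ hgm] with ω h1 h2 h3
        rw [← h2 _ h3]; exact h1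
      · filter_upwards [hval, AEEqFun.coeFn_mk _ hgm, coe_sub' (AEEqFun.mk _ hgm) (u y + α),
          coe_add' (u y) α] with ω h2 h3 h4 h5
        apply h2
        rw [h4, h5, ← h3]; ring
    have hC := mem_of_only_trivial hnrm C ?_ ?_ ?_ ?_ ?_
    · refine ⟨u, hu, α, fun x => ?_⟩
      have h1 := hC x
      simp only [C, zero_add] at h1
      filter_upwards [h1, hmin x] with ω a b
      exact le_antisymm a b
    · obtain ⟨r, hr, -⟩ := hmk x₁ (f x₁) (hmeas x₁) (by simp) hx₁
      exact ⟨x₁, r, hr⟩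
    · intro ξ h0 h1 y r z s hy hz
      have e : ξ * r + (1 - ξ) * s + (u (ξ • y + (1 - ξ) • z) + α) =
          ξ * (r + (u y + α)) + (1 - ξ) * (s + (u z + α)) := by
        rw [map_add, map_smul, map_smul, smul_eq_mul, smul_eq_mul]; ring
      show ∀ᵐ ω ∂μ, _
      rw [e]
      filter_upwards [hy, hz, hconv ξ h0 h1 y z, (le_iff' _ _).1 h0,
        (le_iff' _ _).1 (sub_nonneg.2 h1), coe_zero' (μ := μ),
        coe_add' (ξ * (r + (u y + α))) ((1 - ξ) * (s + (u z + α))),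
        coe_mul' ξ (r + (u y + α)), coe_mul' (1 - ξ) (s + (u z + α))]
        with ω a1 a2 a3 a4 a5 a6 a7 a8 a9
      rw [a6] at a4 a5
      rw [a7, a8, a9, EReal.coe_add, EReal.coe_mul, EReal.coe_mul]
      exact a3.trans (add_le_add
        (mul_le_mul_of_nonneg_left a1 (EReal.coe_nonneg.2 a4))
        (mul_le_mul_of_nonneg_left a2 (EReal.coe_nonneg.2 a5)))
    · intro x r x₀ hx hxl hrl
      refine hclosed x (fun n => r n + (u (x n) + α)) x₀ (0 + (u x₀ + α)) hx
        (dP_tendsto _ hxl) (dP_tendsto _ ?_)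
      obtain ⟨ζ, hζ0, hζ⟩ := hu
      have hb : ∀ᵐ ω ∂μ, ∀ n, (r n + (u (x n) + α) - (0 + (u x₀ + α))) ω =
          r n ω + u (x n - x₀) ω ∧ |u (x n - x₀) ω| ≤ ζ ω * nrm (x n - x₀) ω := by
        rw [ae_all_iff]
        intro n
        have e : r n + (u (x n) + α) - (0 + (u x₀ + α)) = r n + u (x n - x₀) := by
          rw [map_sub]; ring
        rw [e]
        filter_upwards [coe_add' (r n) (u (x n - x₀)), (le_iff' _ _).1 (hζ (x n - x₀)),
          coe_abs' (u (x n - x₀)), coe_mul' ζ (nrm (x n - x₀))] with ω b1 b2 b3 b4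
        rw [b3, b4] at b2
        exact ⟨b1, b2⟩
      filter_upwards [hb, hxl, hrl] with ω b1 b2 b3
      simp only [(b1 _).1]
      have h2 : Tendsto (fun n => ζ ω * nrm (x n - x₀) ω) atTop (𝓝 0) := by
        simpa using b2.const_mul (ζ ω)
      have h3 : Tendsto (fun n => u (x n - x₀) ω) atTop (𝓝 0) :=
        squeeze_zero_norm (fun n => (b1 n).2) h2
      simpa using b3.add h3
    · intro y r hy
      rw [le_iff']
      filter_upwards [hy, hmin y, coe_add' r (u y + α), coe_zero' (μ := μ)] with ω a1 a2 a3 a4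
      have := EReal.coe_le_coe_iff.1 (a2.trans a1)
      rw [a3] at this
      rw [a4]; linarith
    · intro v hv m hvm
      have hq : ((u + v, α + m) : (E →ₗ[Ω →ₘ[μ] ℝ] (Ω →ₘ[μ] ℝ)) × (Ω →ₘ[μ] ℝ)) ∈
          {q : (E →ₗ[Ω →ₘ[μ] ℝ] (Ω →ₘ[μ] ℝ)) × (Ω →ₘ[μ] ℝ) |
            IsBoundedLF nrm q.1 ∧
              ∀ x : E, ∀ᵐ ω ∂μ, (((q.1 x + q.2) ω : ℝ) : EReal) ≤ f x ω} := by
        constructor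
        · obtain ⟨a, ha0, ha⟩ := hu
          obtain ⟨b, hb0, hb⟩ := hv
          refine ⟨a + b, add_nonneg ha0 hb0, fun x => ?_⟩
          rw [LinearMap.add_apply, add_mul]
          exact (abs_add_le _ _).trans (add_le_add (ha x) (hb x))
        · intro x
          obtain ⟨ξ, h0, h1, hξ⟩ := ind_exists (μ := μ) {ω | f x ω < ⊤}
            (nullMeasurableSet_lt (hmeas x) aemeasurable_const)
          have hgm : AEMeasurable (fun ω => ((ξ ω : ℝ) : EReal) * f x ω +
              (((1 - ξ : Ω →ₘ[μ] ℝ) ω : ℝ) : EReal) * f x₁ ω) μ := by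
            have e1 := ξ.measurable.coe_real_ereal.aemeasurable (μ := μ)
            have e2 := (1 - ξ : Ω →ₘ[μ] ℝ).measurable.coe_real_ereal.aemeasurable (μ := μ)
            exact (e1.mul (hmeas x)).add (e2.mul (hmeas x₁))
          obtain ⟨r, hr, hrv⟩ := hmk (ξ • x + (1 - ξ) • x₁) _ hgm (hconv ξ h0 h1 x x₁) (by
            filter_upwards [hξ, coe_sub' 1 ξ, coe_one' (μ := μ), hx₁] with ω a1 a2 a3 a4
            rw [a2, a3, a1]
            by_cases h : f x ω < ⊤
            · simp [h]
            · simp [h, a4])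
          have hk := (le_iff' _ _).1 (hvm _ _ hr)
          have hlin : ∀ w : E →ₗ[Ω →ₘ[μ] ℝ] (Ω →ₘ[μ] ℝ), ∀ᵐ ω ∂μ,
              w (ξ • x + (1 - ξ) • x₁) ω = ξ ω * w x ω + (1 - ξ ω) * w x₁ ω := by
            intro w
            rw [map_add, map_smul, map_smul, smul_eq_mul, smul_eq_mul]
            filter_upwards [coe_add' (ξ * w x) ((1 - ξ) * w x₁), coe_mul' ξ (w x),
              coe_mul' (1 - ξ) (w x₁), coe_sub' 1 ξ, coe_one' (μ := μ)] with ω a1 a2 a3 a4 a5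
            rw [a1, a2, a3, a4, a5]
          filter_upwards [hξ, coe_sub' 1 ξ, coe_one' (μ := μ), hrv, hk, hlin u, hlin v,
            coe_add' (v (ξ • x + (1 - ξ) • x₁)) m, coe_add' ((u + v) x) (α + m),
            coe_add' (u x) (v x), coe_add' α m] with ω a1 a2 a3 a4 a5 a6 a7 a8 a9 a10 a11
          by_cases h : f x ω < ⊤
          · have hξ1 : ξ ω = 1 := by simpa [h] using a1
            rw [a2, a3, a6, hξ1] at a4
            rw [hξ1] at a7
            rw [a8, a7] at a5
            simp only [sub_self, EReal.coe_zero, EReal.coe_one, one_mul, zero_mul, add_zero] at a4 a5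
            rw [a4, EReal.coe_le_coe_iff]
            rw [a9, LinearMap.add_apply, a10, a11]
            linarith
          · rw [not_lt_top_iff.1 h]; exact le_top
      rw [hset] at hq
      obtain ⟨q1, q2⟩ := hq
      exact ⟨by simpa using q1, by simpa using q2⟩

end RandomNormed
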